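/- arXiv:2508.20285 — 2 statements merged into one kernel-verified Lean document; each statement's English description precedes it below -/
import Mathlib

section
/- Let P, P', G, Q be groups, let u : P → G and u' : P' → G be group homomorphisms, and let v : G → Q and v' : G → Q be surjective group homomorphisms such that ker v = range u and ker v' = range u'. Assume Q is Hopfian. If the composition v' ∘ u is the trivial homomorphism, then range u = range u', and consequently the composition v ∘ u' is also trivial. -/
/-- A group `Q` is Hopfian if every surjective group endomorphism of `Q` is injective. -/
def IsHopfianGroup (Q : Type*) [Group Q] : Prop :=
  ∀ f : Q →* Q, Function.Surjective f → Function.Injective f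

theorem range_eq_and_comp_trivial_of_isHopfian
    {P P' G Q : Type*} [Group P] [Group P'] [Group G] [Group Q]
    (hQ : IsHopfianGroup Q)
    (u : P →* G) (u' : P' →* G) (v : G →* Q) (v' : G →* Q)
    (hv : Function.Surjective v) (hv' : Function.Surjective v')
    (hker : v.ker = u.range) (hker' : v'.ker = u'.range)
    (h : v'.comp u = 1) :
    u.range = u'.range ∧ v.comp u' = 1 := by
  have hle : v.ker ≤ v'.ker := by
    rw [hker]
    rintro _ ⟨p, rfl⟩
    exact DFunLike.congr_fun h p
  let f : Q →* Q := v.liftOfSurjective hv ⟨v', hle⟩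
  have hf (g : G) : f (v g) = v' g :=
    v.liftOfRightInverse_comp_apply _ (Function.rightInverse_surjInv hv) ⟨v', hle⟩ g
  have hf_inj : Function.Injective f := hQ f fun q => by
    obtain ⟨g, rfl⟩ := hv' q
    exact ⟨v g, hf g⟩
  have hker_eq : v.ker = v'.ker := by
    refine le_antisymm hle fun g hg => ?_
    rw [MonoidHom.mem_ker] at hg ⊢
    exact hf_inj (by rw [hf, hg, map_one])
  refine ⟨by rw [← hker, hker_eq, hker'], MonoidHom.ext fun p => ?_⟩
  have hp : u' p ∈ v.ker := by
    rw [hker_eq, hker']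
    exact ⟨p, rfl⟩
  exact hp
end

section
/- Let P, P', G, Q be groups, let u : P → G and u' : P' → G be group homomorphisms, and let v : G → Q and v' : G → Q be surjective group homomorphisms such that ker v = range u and ker v' = range u'. Assume Q is Hopfian. Then the composition v' ∘ u is the trivial homomorphism if and only if the composition v ∘ u' is the trivial homomorphism. -/
/-- If two surjections onto a Hopfian group have nested kernels, the reverse inclusion holds. -/
theorem IsHopfianGroup.ker_le_ker_of_le {G Q : Type*} [Group G] [Group Q]
    (hQ : IsHopfianGroup Q) {v v' : G →* Q} (hv : Function.Surjective v)
    (hv' : Function.Surjective v') (h : v.ker ≤ v'.ker) : v'.ker ≤ v.ker := by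
  set f : Q →* Q := v.liftOfSurjective hv ⟨v', h⟩
  have hf : ∀ x, f (v x) = v' x :=
    MonoidHom.liftOfRightInverse_comp_apply v _ (Function.rightInverse_surjInv hv) ⟨v', h⟩
  have hinj : Function.Injective f := hQ f fun q => by
    obtain ⟨x, rfl⟩ := hv' q
    exact ⟨v x, hf x⟩
  intro x hx
  rw [MonoidHom.mem_ker] at hx ⊢
  exact hinj (by rw [hf, hx, map_one])

theorem comp_trivial_iff_comp_trivial_of_isHopfian
    {P P' G Q : Type*} [Group P] [Group P'] [Group G] [Group Q]
    (hQ : IsHopfianGroup Q)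
    (u : P →* G) (u' : P' →* G) (v : G →* Q) (v' : G →* Q)
    (hv : Function.Surjective v) (hv' : Function.Surjective v')
    (hker : v.ker = u.range) (hker' : v'.ker = u'.range) :
    v'.comp u = 1 ↔ v.comp u' = 1 := by
  rw [← MonoidHom.range_le_ker_iff, ← MonoidHom.range_le_ker_iff, ← hker, ← hker']
  exact ⟨hQ.ker_le_ker_of_le hv hv', hQ.ker_le_ker_of_le hv' hv⟩
end
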